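/- arXiv:1905.00383 — 6 statements merged into one kernel-verified Lean document; each statement's English description precedes it below -/
import Mathlib

section
/- Let (Ω, 𝓜, P) be a probability space, let K ∈ ℕ, and let E₀, …, E_K ∈ 𝓜 be events (not necessarily independent). Let 𝓕₀ ⊆ 𝓕₁ ⊆ ⋯ ⊆ 𝓕_K ⊆ 𝓜 be sub-σ-algebras such that E_k ∈ 𝓕_{k+1} for each 0 ≤ k ≤ K−1. Then for every α ∈ (0,1), every δ ∈ (0,α), and every integer m ≥ 1, one has P[ { ∑_{k=0}^{K} 1_{ {P[E_k | 𝓕_k] ≥ α} } ≤ K − m } ∩ { ∑_{k=0}^{K} 1_{E_k} ≥ K − (1−α−δ)·m } ] ≤ e⁶ · e^{−2δ²m}. -/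
open MeasureTheory

open ProbabilityTheory in
/-- Hoeffding's lemma for a Bernoulli variable. -/
theorem bernoulli_mgf_le {α : ℝ} (hα0 : 0 ≤ α) (hα1 : α ≤ 1) (t : ℝ) :
    1 - α + α * Real.exp t ≤ Real.exp (α * t + t ^ 2 / 8) := by
  let p : unitInterval := ⟨α, hα0, hα1⟩
  have hmem : ∀ᵐ x ∂(bernoulliMeasure (1 : ℝ) 0 p), id x ∈ Set.Icc (0 : ℝ) 1 := by
    rw [bernoulliMeasure_def, ae_add_measure_iff]
    constructor <;> refine Measure.ae_smul_measure ?_ _ <;> simp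
  have h := (hasSubgaussianMGF_of_mem_Icc aemeasurable_id hmem).mgf_le t
  simp only [mgf, integral_bernoulliMeasure] at h
  simp only [p, id, smul_eq_mul, mul_one, mul_zero, add_zero,
    sub_zero, zero_sub, nnnorm_one] at h
  have hexp : 1 - α + α * Real.exp t
      = Real.exp (α * t) * (α * Real.exp (t * (1 - α)) + (1 - α) * Real.exp (t * -α)) := by
    rw [mul_add, mul_left_comm, ← Real.exp_add, mul_left_comm, ← Real.exp_add]
    ring_nf
    simp only [Real.exp_zero]
    ring
  rw [hexp, Real.exp_add]
  gcongr
  refine h.trans_eq ?_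
  congr 1
  push_cast
  ring

/-- The payoff of a bet on an outcome `e`, placed only when its forecast `p` is below `α`: the stake
is multiplied by `c` if `e = 1` and by `d` if `e = 0`. -/
noncomputable def betFactor (α c d p e : ℝ) : ℝ :=
  if α ≤ p then 1 else d + (c - d) * e

theorem betFactor_indicator_nonneg {Ω : Type*} {α c d : ℝ} (hc : 1 ≤ c) (hd : 0 ≤ d) (p : ℝ)
    (E : Set Ω) (ω : Ω) : 0 ≤ betFactor α c d p (E.indicator (fun _ => 1) ω) := by
  unfold betFactor
  by_cases h : ω ∈ E <;> simp only [h, Set.indicator_of_mem, Set.indicator_of_notMem,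
    not_false_eq_true] <;> split_ifs <;> linarith

theorem betFactor_indicator_le {Ω : Type*} {α c d : ℝ} (hc : 1 ≤ c) (hdc : d ≤ c) (p : ℝ)
    (E : Set Ω) (ω : Ω) : betFactor α c d p (E.indicator (fun _ => 1) ω) ≤ c := by
  unfold betFactor
  by_cases h : ω ∈ E <;> simp only [h, Set.indicator_of_mem, Set.indicator_of_notMem,
    not_false_eq_true] <;> split_ifs <;> linarith

theorem exp_le_betFactor_indicator {Ω : Type*} {α a t : ℝ} (ht : 0 ≤ t) (p : ℝ)
    (E : Set Ω) (ω : Ω) :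
    Real.exp (a * (1 - if α ≤ p then 1 else 0) - t * (1 - E.indicator (fun _ => 1) ω))
      ≤ betFactor α (Real.exp a) (Real.exp (a - t)) p (E.indicator (fun _ => 1) ω) := by
  unfold betFactor
  by_cases h : ω ∈ E <;> by_cases hp : α ≤ p <;> simp [h, hp, ht]

theorem stronglyMeasurable_betFactor {Ω : Type*} {𝓗 : MeasurableSpace Ω} {p e : Ω → ℝ}
    (hp : StronglyMeasurable[𝓗] p) (he : StronglyMeasurable[𝓗] e) (α c d : ℝ) :
    StronglyMeasurable[𝓗] (fun ω => betFactor α c d (p ω) (e ω)) :=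
  StronglyMeasurable.ite (measurableSet_le measurable_const hp.measurable)
    stronglyMeasurable_const (stronglyMeasurable_const.add (he.const_mul _))

/-- A bet on an event against its conditional probability has no gain in expectation. -/
theorem integral_mul_betFactor_le {Ω : Type*} {𝓗 m𝓜 : MeasurableSpace Ω} (h𝓗 : 𝓗 ≤ m𝓜)
    (P : Measure Ω) [IsProbabilityMeasure P] {E : Set Ω} (hE : MeasurableSet E)
    {W : Ω → ℝ} (hW : StronglyMeasurable[𝓗] W) (hW0 : ∀ ω, 0 ≤ W ω) {B : ℝ} (hWB : ∀ ω, W ω ≤ B)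
    {α c d : ℝ} (hdc : d ≤ c) (hfair : α * c + (1 - α) * d ≤ 1) :
    ∫ ω, W ω * betFactor α c d ((P[E.indicator (fun _ => (1 : ℝ)) | 𝓗]) ω)
        (E.indicator (fun _ => 1) ω) ∂P ≤ ∫ ω, W ω ∂P := by
  set p := P[E.indicator (fun _ => (1 : ℝ)) | 𝓗] with hp
  have hpm : StronglyMeasurable[𝓗] p := stronglyMeasurable_condExp
  have hpset : MeasurableSet[𝓗] {ω | α ≤ p ω} :=
    measurableSet_le measurable_const hpm.measurable
  have hEint : Integrable (E.indicator (fun _ => (1 : ℝ))) P :=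
    (integrable_const 1).indicator hE
  let u : Ω → ℝ := fun ω => W ω * if α ≤ p ω then 1 else d
  let v : Ω → ℝ := fun ω => W ω * if α ≤ p ω then 0 else c - d
  have hu : StronglyMeasurable[𝓗] u :=
    hW.mul (StronglyMeasurable.ite hpset stronglyMeasurable_const stronglyMeasurable_const)
  have hv : StronglyMeasurable[𝓗] v :=
    hW.mul (StronglyMeasurable.ite hpset stronglyMeasurable_const stronglyMeasurable_const)
  have habs : ∀ ω, |W ω| ≤ B := fun ω => by rw [abs_of_nonneg (hW0 ω)]; exact hWB ω
  have hubd : ∀ ω, ‖u ω‖ ≤ B * max 1 |d| := fun ω => by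
    rw [Real.norm_eq_abs, abs_mul]
    have : |if α ≤ p ω then 1 else d| ≤ max 1 |d| := by split_ifs <;> simp
    exact mul_le_mul (habs ω) this (abs_nonneg _) ((abs_nonneg _).trans (habs ω))
  have hvbd : ∀ ω, ‖v ω‖ ≤ B * |c - d| := fun ω => by
    rw [Real.norm_eq_abs, abs_mul]
    have : |if α ≤ p ω then 0 else c - d| ≤ |c - d| := by split_ifs <;> simp
    exact mul_le_mul (habs ω) this (abs_nonneg _) ((abs_nonneg _).trans (habs ω))
  have huint : Integrable u P :=
    .of_bound (hu.mono h𝓗).aestronglyMeasurable _ (ae_of_all _ hubd)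
  have hWint : Integrable W P :=
    .of_bound (hW.mono h𝓗).aestronglyMeasurable _ (ae_of_all _ habs)
  have hvE : Integrable (v * E.indicator (fun _ => (1 : ℝ))) P :=
    hEint.bdd_mul (hv.mono h𝓗).aestronglyMeasurable (ae_of_all _ hvbd)
  have hvp : Integrable (v * p) P :=
    integrable_condExp.bdd_mul (hv.mono h𝓗).aestronglyMeasurable (ae_of_all _ hvbd)
  have hpull : ∫ ω, (v * E.indicator (fun _ => (1 : ℝ))) ω ∂P = ∫ ω, (v * p) ω ∂P := by
    rw [← integral_condExp h𝓗]
    exact integral_congr_ae (condExp_mul_of_stronglyMeasurable_left hv hvE hEint)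
  calc ∫ ω, W ω * betFactor α c d (p ω) (E.indicator (fun _ => 1) ω) ∂P
      = ∫ ω, (u ω + (v * E.indicator (fun _ => (1 : ℝ))) ω) ∂P := by
        refine integral_congr_ae (ae_of_all _ fun ω => ?_)
        simp only [betFactor, u, v, Pi.mul_apply]
        split_ifs <;> ring
    _ = ∫ ω, (u ω + (v * p) ω) ∂P := by
        rw [integral_add huint hvE, integral_add huint hvp, hpull]
    _ ≤ ∫ ω, W ω ∂P := by
        refine integral_mono (huint.add hvp) hWint fun ω => ?_
        simp only [u, v, Pi.mul_apply]
        split_ifs with h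
        · simp
        · have : d + (c - d) * p ω ≤ 1 := by nlinarith
          nlinarith [mul_le_mul_of_nonneg_left this (hW0 ω)]

section BettingProduct

variable {Ω : Type*} {m𝓜 : MeasurableSpace Ω} (P : Measure Ω) (E : ℕ → Set Ω)
  (𝓕 : ℕ → MeasurableSpace Ω) (α c d : ℝ)

/-- The wealth after `n` bets on the events `E k` against `P[E k | 𝓕 k]`. -/
noncomputable def betWealth (n : ℕ) (ω : Ω) : ℝ :=
  ∏ k ∈ Finset.range n, betFactor α c d ((P[(E k).indicator (fun _ => (1 : ℝ)) | 𝓕 k]) ω)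
    ((E k).indicator (fun _ => 1) ω)

variable {P E 𝓕 α c d}

theorem betWealth_nonneg (hc : 1 ≤ c) (hd : 0 ≤ d) (n : ℕ) (ω : Ω) :
    0 ≤ betWealth P E 𝓕 α c d n ω :=
  Finset.prod_nonneg fun _ _ => betFactor_indicator_nonneg hc hd _ _ ω

theorem betWealth_le (hc : 1 ≤ c) (hd : 0 ≤ d) (hdc : d ≤ c) (n : ℕ) (ω : Ω) :
    betWealth P E 𝓕 α c d n ω ≤ c ^ n := by
  simpa [betWealth] using Finset.prod_le_prod (s := Finset.range n)
    (fun k _ => betFactor_indicator_nonneg hc hd _ (E k) ω)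
    (fun k _ => betFactor_indicator_le hc hdc _ (E k) ω)

theorem stronglyMeasurable_betWealth {n : ℕ} {𝓗 : MeasurableSpace Ω}
    (h𝓕 : ∀ k < n, 𝓕 k ≤ 𝓗) (hE : ∀ k < n, MeasurableSet[𝓗] (E k)) :
    StronglyMeasurable[𝓗] (betWealth P E 𝓕 α c d n) := by
  refine Finset.stronglyMeasurable_fun_prod _ fun k hk => ?_
  have hk := Finset.mem_range.1 hk
  exact stronglyMeasurable_betFactor (stronglyMeasurable_condExp.mono (h𝓕 k hk))
    (StronglyMeasurable.indicator (@stronglyMeasurable_const _ _ 𝓗 _ _) (hE k hk)) α c d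

theorem integral_betWealth_le_one [IsProbabilityMeasure P] {K : ℕ}
    (hEmeas : ∀ k ≤ K, MeasurableSet (E k)) (h𝓕le : ∀ k ≤ K, 𝓕 k ≤ m𝓜)
    (h𝓕mono : ∀ j k, j ≤ k → k ≤ K → 𝓕 j ≤ 𝓕 k)
    (hadapted : ∀ k, k + 1 ≤ K → MeasurableSet[𝓕 (k + 1)] (E k))
    (hc : 1 ≤ c) (hd : 0 ≤ d) (hdc : d ≤ c) (hfair : α * c + (1 - α) * d ≤ 1)
    {n : ℕ} (hn : n ≤ K + 1) :
    ∫ ω, betWealth P E 𝓕 α c d n ω ∂P ≤ 1 := by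
  induction n with
  | zero => simp [betWealth]
  | succ n ih =>
    have hnK : n ≤ K := by lia
    refine le_trans ?_ (ih (by lia))
    simp only [betWealth, Finset.prod_range_succ]
    exact integral_mul_betFactor_le (h𝓕le n hnK) P (hEmeas n hnK)
      (stronglyMeasurable_betWealth (fun k hk => h𝓕mono k n hk.le hnK)
        fun k hk => h𝓕mono (k + 1) n hk hnK _ (hadapted k (by lia)))
      (betWealth_nonneg hc hd n) (betWealth_le hc hd hdc n) hdc hfair

end BettingProduct

theorem stmt_3 {Ω : Type*} [m𝓜 : MeasurableSpace Ω] (P : Measure Ω) [IsProbabilityMeasure P]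
    (K : ℕ) (E : ℕ → Set Ω) (hEmeas : ∀ k ≤ K, MeasurableSet (E k))
    (𝓕 : ℕ → MeasurableSpace Ω)
    (h𝓕le : ∀ k ≤ K, 𝓕 k ≤ m𝓜)
    (h𝓕mono : ∀ j k, j ≤ k → k ≤ K → 𝓕 j ≤ 𝓕 k)
    (hadapted : ∀ k, k + 1 ≤ K → MeasurableSet[𝓕 (k + 1)] (E k))
    (α δ : ℝ) (hα : α ∈ Set.Ioo (0 : ℝ) 1) (hδ : δ ∈ Set.Ioo (0 : ℝ) α)
    (m : ℕ) (hm : 1 ≤ m) :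
    P {ω | (∑ k ∈ Finset.range (K + 1),
              if α ≤ (P[(E k).indicator (fun _ => (1 : ℝ)) | 𝓕 k]) ω then (1 : ℝ) else 0)
            ≤ (K : ℝ) - m
          ∧ (K : ℝ) - (1 - α - δ) * m
            ≤ ∑ k ∈ Finset.range (K + 1), (E k).indicator (fun _ => (1 : ℝ)) ω}
      ≤ ENNReal.ofReal (Real.exp 6 * Real.exp (-2 * δ ^ 2 * m)) := by
  obtain ⟨hα0, hα1⟩ := hα
  obtain ⟨hδ0, hδα⟩ := hδ
  set t : ℝ := 4 * δ with ht
  have ht0 : 0 ≤ t := by positivity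
  have hψ0 : 0 < 1 - α + α * Real.exp t := by
    have := Real.exp_pos t
    nlinarith
  set a : ℝ := t - Real.log (1 - α + α * Real.exp t) with ha
  have hexpa : Real.exp a = Real.exp t / (1 - α + α * Real.exp t) := by
    rw [ha, Real.exp_sub, Real.exp_log hψ0]
  have hexpat : Real.exp (a - t) = 1 / (1 - α + α * Real.exp t) := by
    rw [Real.exp_sub, hexpa]
    field_simp
  have ha0 : 0 ≤ a := by
    rw [ha, sub_nonneg, Real.log_le_iff_le_exp hψ0]
    nlinarith [Real.one_le_exp ht0]
  have hlog : t - a ≤ α * t + t ^ 2 / 8 := by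
    rw [ha, sub_sub_cancel, Real.log_le_iff_le_exp hψ0]
    exact bernoulli_mgf_le hα0.le hα1.le t
  have hc : 1 ≤ Real.exp a := Real.one_le_exp ha0
  have hd : 0 ≤ Real.exp (a - t) := (Real.exp_pos _).le
  have hdc : Real.exp (a - t) ≤ Real.exp a := Real.exp_le_exp.2 (by linarith)
  have hfair : α * Real.exp a + (1 - α) * Real.exp (a - t) ≤ 1 := by
    rw [hexpa, hexpat]
    refine le_of_eq ?_
    field_simp
    ring
  set W := betWealth P E 𝓕 α (Real.exp a) (Real.exp (a - t)) (K + 1) with hW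
  have hWm : StronglyMeasurable W := stronglyMeasurable_betWealth
    (fun k hk => h𝓕le k (Nat.lt_succ_iff.1 hk)) (fun k hk => hEmeas k (Nat.lt_succ_iff.1 hk))
  have hW0 : ∀ ω, 0 ≤ W ω := betWealth_nonneg hc hd _
  have hWint : Integrable W P := .of_bound hWm.aestronglyMeasurable (Real.exp a ^ (K + 1))
    (ae_of_all _ fun ω => by
      rw [Real.norm_of_nonneg (hW0 ω)]
      exact betWealth_le hc hd hdc _ ω)
  set x : ℝ := a * m - t * (1 + (1 - α - δ) * m) with hx
  have hmarkov : P.real {ω | Real.exp x ≤ W ω} ≤ Real.exp (-x) := by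
    have h := (mul_meas_ge_le_integral_of_nonneg (ae_of_all _ hW0) hWint (Real.exp x)).trans
      (integral_betWealth_le_one hEmeas h𝓕le h𝓕mono hadapted hc hd hdc hfair le_rfl)
    rwa [Real.exp_neg, ← one_div, le_div_iff₀' (Real.exp_pos x)]
  have hx_le : -x ≤ 6 + -2 * δ ^ 2 * m := by
    have hm0 : (0 : ℝ) ≤ m := m.cast_nonneg
    have := mul_le_mul_of_nonneg_right hlog hm0
    rw [ht] at this
    rw [hx, ht]
    nlinarith
  refine (measure_mono (t := {ω | Real.exp x ≤ W ω}) ?_).trans ?_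
  · rintro ω ⟨hgood, hsucc⟩
    refine le_trans ?_ (Finset.prod_le_prod (fun _ _ => (Real.exp_pos _).le)
      fun k _ => exp_le_betFactor_indicator (α := α) (a := a) ht0 _ (E k) ω)
    rw [← Real.exp_sum, Real.exp_le_exp, Finset.sum_sub_distrib, ← Finset.mul_sum,
      ← Finset.mul_sum, Finset.sum_sub_distrib, Finset.sum_sub_distrib, Finset.sum_const,
      Finset.card_range, nsmul_one, hx]
    push_cast
    gcongr <;> linarith
  · rw [← ofReal_measureReal]
    refine ENNReal.ofReal_le_ofReal (hmarkov.trans ?_)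
    rw [← Real.exp_add]
    exact Real.exp_le_exp.2 hx_le
end

section
/- Let (Ω, 𝓜, P) be a probability space, let K ∈ ℕ, and let 𝓕₀ ⊆ 𝓕₁ ⊆ ⋯ ⊆ 𝓕_K ⊆ 𝓜 be sub-σ-algebras. Let E₀, …, E_K ∈ 𝓜 be events with E_k ∈ 𝓕_{k+1} for each 0 ≤ k ≤ K−1. Fix α ∈ (0,1) and fixed versions of the conditional probabilities P[E_k | 𝓕_k]. For each j ≥ 1 let τ_j be the j-th smallest k ∈ {0, …, K} such that P[E_k | 𝓕_k] < α, with τ_j := K+1 if there are fewer than j such k. Then for every m ∈ ℕ and every integer n ≥ 0, P[ {τ_{m+1} ≤ K} ∩ { #{ j ∈ {1, …, m+1} : E_{τ_j} does not occur } ≤ n } ] ≤ ∑_{i=0}^{n} C(m+1, i) · (1−α)ⁱ · α^{m+1−i}, i.e., on the event {τ_{m+1} ≤ K} the number of indices j ∈ {1,…,m+1} for which E_{τ_j} fails stochastically dominates a binomial random variable with m+1 trials and success probability 1−α. -/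
open MeasureTheory

/-- The `j`-th smallest `k ∈ {0, …, K}` such that `f k ω < α`, or `K + 1` if there are fewer
than `j` such `k`. -/
noncomputable def tauIndex {Ω : Type*} (K : ℕ) (α : ℝ) (f : ℕ → Ω → ℝ) (j : ℕ) (ω : Ω) : ℕ :=
  (((Finset.range (K + 1)).filter (fun k => f k ω < α)).sort (· ≤ ·)).getD (j - 1) (K + 1)

/-- The probability of fewer than `s` successes in `r` trials with failure probability `α`. -/
noncomputable def binomLT (α : ℝ) : ℕ → ℕ → ℝ
  | 0, s => if s = 0 then 0 else 1
  | r + 1, s => α * binomLT α r s + (1 - α) * binomLT α r (s - 1)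

lemma binomLT_zero_right (α : ℝ) (r : ℕ) : binomLT α r 0 = 0 := by
  induction r with
  | zero => simp [binomLT]
  | succ r ih => simp [binomLT, ih]

lemma binomLT_eq_sum (α : ℝ) (r s : ℕ) :
    binomLT α r s =
      ∑ i ∈ Finset.range s, (r.choose i : ℝ) * (1 - α) ^ i * α ^ (r - i) := by
  induction r generalizing s with
  | zero =>
    cases s with
    | zero => simp [binomLT]
    | succ s => simp [binomLT, Finset.sum_range_succ']
  | succ r ih =>
    cases s with
    | zero => simp [binomLT_zero_right]
    | succ s =>
      rw [binomLT, ih, ih, Nat.add_sub_cancel, Finset.sum_range_succ', Finset.sum_range_succ',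
        mul_add, Finset.mul_sum, Finset.mul_sum, add_right_comm, ← Finset.sum_add_distrib]
      congr 1
      · refine Finset.sum_congr rfl fun i _ => ?_
        rw [Nat.choose_succ_succ, Nat.add_sub_add_right]
        rcases Nat.lt_or_ge i r with h | h
        · obtain ⟨d, rfl⟩ := Nat.exists_eq_add_of_lt h
          rw [show i + d + 1 - (i + 1) = d by omega, show i + d + 1 - i = d + 1 by omega]
          push_cast
          ring
        · rw [Nat.choose_eq_zero_of_lt (Nat.lt_succ_of_le h)]
          push_cast
          ring
      · simp [pow_succ']

lemma binomLT_nonneg {α : ℝ} (h0 : 0 ≤ α) (h1 : α ≤ 1) (r s : ℕ) : 0 ≤ binomLT α r s := by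
  rw [binomLT_eq_sum]
  have := sub_nonneg.2 h1
  positivity

lemma binomLT_le_one {α : ℝ} (h0 : 0 ≤ α) (h1 : α ≤ 1) (r s : ℕ) : binomLT α r s ≤ 1 := by
  induction r generalizing s with
  | zero => rw [binomLT]; split_ifs <;> norm_num
  | succ r ih => rw [binomLT]; nlinarith [ih s, ih (s - 1)]

lemma binomLT_mono {α : ℝ} (h0 : 0 ≤ α) (h1 : α ≤ 1) (r : ℕ) : Monotone (binomLT α r) := by
  intro s t hst
  simp only [binomLT_eq_sum]
  have := sub_nonneg.2 h1
  exact Finset.sum_le_sum_of_subset_of_nonneg (Finset.range_mono hst)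
    fun _ _ _ => by positivity

section Counting

variable {Ω : Type*}

/-- The number of indices `i < k` for which `S i` occurs. -/
noncomputable def hitCount (S : ℕ → Set Ω) (k : ℕ) (ω : Ω) : ℕ :=
  ∑ i ∈ Finset.range k, (S i).indicator (fun _ => 1) ω

/-- The number of indices `i < k`, among the first `M` for which `S i` occurs, such that `E i`
fails. -/
noncomputable def missCount (S E : ℕ → Set Ω) (M k : ℕ) (ω : Ω) : ℕ :=
  ∑ i ∈ Finset.range k, ((S i \ E i) ∩ {ω | hitCount S i ω < M}).indicator (fun _ => 1) ω

/-- The binomial probability of the remaining trials after the first `k` indices. -/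
noncomputable def binomProcess (α : ℝ) (S E : ℕ → Set Ω) (M s k : ℕ) (ω : Ω) : ℝ :=
  binomLT α (M - hitCount S k ω) (s - missCount S E M k ω)

/-- The predictable factor of the increments of `binomProcess`. -/
noncomputable def binomWeight (α : ℝ) (S E : ℕ → Set Ω) (M s k : ℕ) : Ω → ℝ :=
  (S k ∩ {ω | hitCount S k ω < M}).indicator fun ω =>
    binomLT α (M - hitCount S k ω - 1) (s - missCount S E M k ω) -
      binomLT α (M - hitCount S k ω - 1) (s - missCount S E M k ω - 1)

lemma binomProcess_succ (α : ℝ) (S E : ℕ → Set Ω) (M s k : ℕ) (ω : Ω) :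
    binomProcess α S E M s (k + 1) ω = binomProcess α S E M s k ω +
      binomWeight α S E M s k ω * ((E k).indicator (fun _ => (1 : ℝ)) ω - α) := by
  have hN : hitCount S (k + 1) ω = hitCount S k ω + (S k).indicator (fun _ => 1) ω :=
    Finset.sum_range_succ _ _
  have hF : missCount S E M (k + 1) ω = missCount S E M k ω +
      ((S k \ E k) ∩ {ω | hitCount S k ω < M}).indicator (fun _ => 1) ω :=
    Finset.sum_range_succ _ _
  simp only [binomProcess, binomWeight, hN, hF]
  by_cases hS : ω ∈ S k
  · by_cases hM : hitCount S k ω < M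
    · obtain ⟨r, hr⟩ : ∃ r, M - hitCount S k ω = r + 1 := ⟨M - hitCount S k ω - 1, by omega⟩
      have hr' : M - (hitCount S k ω + 1) = r := by omega
      by_cases hE : ω ∈ E k
      · simp [hS, hM, hE, hr, hr', binomLT]
        ring
      · simp [hS, hM, hE, hr, hr', binomLT, ← Nat.sub_sub]
        ring
    · have h1 : M - hitCount S k ω = 0 := by omega
      have h2 : M - (hitCount S k ω + 1) = 0 := by omega
      simp [hS, hM, h1, h2]
  · simp [hS]

lemma binomWeight_nonneg {α : ℝ} (h0 : 0 ≤ α) (h1 : α ≤ 1) (S E : ℕ → Set Ω) (M s k : ℕ)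
    (ω : Ω) : 0 ≤ binomWeight α S E M s k ω :=
  Set.indicator_nonneg (fun _ _ => sub_nonneg.2 (binomLT_mono h0 h1 _ (Nat.sub_le _ _))) _

lemma abs_binomWeight_le {α : ℝ} (h0 : 0 ≤ α) (h1 : α ≤ 1) (S E : ℕ → Set Ω) (M s k : ℕ)
    (ω : Ω) : |binomWeight α S E M s k ω| ≤ 1 := by
  rw [abs_of_nonneg (binomWeight_nonneg h0 h1 ..)]
  refine Set.indicator_le' (fun ω _ => ?_) (fun _ _ => zero_le_one) ω
  linarith [binomLT_le_one h0 h1 (M - hitCount S k ω - 1) (s - missCount S E M k ω),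
    binomLT_nonneg h0 h1 (M - hitCount S k ω - 1) (s - missCount S E M k ω - 1)]

variable {m : MeasurableSpace Ω} {S E : ℕ → Set Ω} {k : ℕ}

lemma measurable_hitCount (hS : ∀ i < k, MeasurableSet (S i)) : Measurable (hitCount S k) :=
  Finset.measurable_fun_sum _ fun i hi =>
    measurable_const.indicator (hS i (Finset.mem_range.1 hi))

lemma measurable_missCount (hS : ∀ i < k, MeasurableSet (S i))
    (hE : ∀ i < k, MeasurableSet (E i)) (M : ℕ) : Measurable (missCount S E M k) := by
  refine Finset.measurable_fun_sum _ fun i hi => measurable_const.indicator ?_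
  have hi := Finset.mem_range.1 hi
  exact ((hS i hi).diff (hE i hi)).inter
    (measurableSet_lt (measurable_hitCount fun j hj => hS j (hj.trans hi)) measurable_const)

lemma measurable_binomProcess (α : ℝ) (hS : ∀ i < k, MeasurableSet (S i))
    (hE : ∀ i < k, MeasurableSet (E i)) (M s : ℕ) :
    Measurable (binomProcess α S E M s k) :=
  (Measurable.of_discrete (f := fun p : ℕ × ℕ => binomLT α (M - p.1) (s - p.2))).comp
    ((measurable_hitCount hS).prodMk (measurable_missCount hS hE M))

lemma measurable_binomWeight (α : ℝ) (hS : ∀ i < k + 1, MeasurableSet (S i))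
    (hE : ∀ i < k, MeasurableSet (E i)) (M s : ℕ) :
    Measurable (binomWeight α S E M s k) := by
  have hN : Measurable (hitCount S k) := measurable_hitCount fun i hi => hS i (by omega)
  refine Measurable.indicator ?_
    ((hS k (by omega)).inter (measurableSet_lt hN measurable_const))
  exact (Measurable.of_discrete (f := fun p : ℕ × ℕ =>
    binomLT α (M - p.1 - 1) (s - p.2) - binomLT α (M - p.1 - 1) (s - p.2 - 1))).comp
    (hN.prodMk (measurable_missCount (fun i hi => hS i (by omega)) hE M))

end Counting

/-- A conditional probability below `α` wherever a nonnegative weight is nonzero gives the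
corresponding bound on the weighted integral. -/
lemma integral_mul_indicator_sub_nonpos {Ω : Type*} {m m0 : MeasurableSpace Ω} {P : Measure Ω}
    [IsProbabilityMeasure P] (hm : m ≤ m0) {A : Set Ω} (hA : MeasurableSet A) {g W : Ω → ℝ}
    {α C : ℝ} (hg : g =ᵐ[P] P[A.indicator (fun _ => (1 : ℝ)) | m]) (hW : Measurable[m] W)
    (hW0 : ∀ ω, 0 ≤ W ω) (hWC : ∀ ω, |W ω| ≤ C) (hWg : ∀ ω, W ω ≠ 0 → g ω ≤ α) :
    ∫ ω, W ω * (A.indicator (fun _ => (1 : ℝ)) ω - α) ∂P ≤ 0 := by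
  have hWi : Integrable W P :=
    .of_bound (hW.mono hm le_rfl).aestronglyMeasurable C (.of_forall hWC)
  have hAi : Integrable (A.indicator fun _ => (1 : ℝ)) P := (integrable_const 1).indicator hA
  have hWA : Integrable (W * A.indicator fun _ => (1 : ℝ)) P :=
    hAi.bdd_mul (c := C) hWi.aestronglyMeasurable (.of_forall hWC)
  have hce : W * g =ᵐ[P] P[W * A.indicator (fun _ => (1 : ℝ)) | m] := by
    filter_upwards [hg, condExp_mul_of_stronglyMeasurable_left hW.stronglyMeasurable hWA hAi]
      with ω h1 h2
    rw [h2, Pi.mul_apply, Pi.mul_apply, h1]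
  have hWgi : Integrable (W * g) P := integrable_condExp.congr hce.symm
  have hint : ∫ ω, W ω * A.indicator (fun _ => (1 : ℝ)) ω ∂P = ∫ ω, W ω * g ω ∂P :=
    ((integral_congr_ae hce).trans (integral_condExp hm)).symm
  calc ∫ ω, W ω * (A.indicator (fun _ => (1 : ℝ)) ω - α) ∂P
      = ∫ ω, W ω * A.indicator (fun _ => (1 : ℝ)) ω ∂P - ∫ ω, W ω * α ∂P := by
        simp only [mul_sub]
        exact integral_sub hWA (hWi.mul_const α)
    _ = ∫ ω, (W ω * g ω - W ω * α) ∂P := by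
        rw [hint]
        exact (integral_sub hWgi (hWi.mul_const α)).symm
    _ ≤ 0 := by
        refine integral_nonpos fun ω => ?_
        rcases eq_or_ne (W ω) 0 with h | h
        · simp [h]
        · exact sub_nonpos.2 (mul_le_mul_of_nonneg_left (hWg ω h) (hW0 ω))

section TauIndex

variable {Ω : Type*} {K : ℕ} {α : ℝ} {f : ℕ → Ω → ℝ} {ω : Ω}

lemma hitCount_eq_card (k : ℕ) :
    hitCount (fun i => {ω | f i ω < α}) k ω =
      ((Finset.range k).filter fun i => f i ω < α).card := by
  simp [hitCount, Set.indicator_apply]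

lemma le_hitCount_of_tauIndex_le {j : ℕ} (h : tauIndex K α f (j + 1) ω ≤ K) :
    j + 1 ≤ hitCount (fun i => {ω | f i ω < α}) (K + 1) ω := by
  rw [hitCount_eq_card]
  by_contra hlt
  rw [tauIndex, List.getD_eq_default _ _ (by simp; omega)] at h
  omega

lemma tauIndex_hitCount_succ {i : ℕ} (hi : i ≤ K) (hf : f i ω < α) :
    tauIndex K α f (hitCount (fun i => {ω | f i ω < α}) i ω + 1) ω = i := by
  set A := (Finset.range (K + 1)).filter fun k => f k ω < α with hA
  have hiA : i ∈ A := by simp [hA, hf]; omega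
  have hcount : hitCount (fun i => {ω | f i ω < α}) i ω = Nat.count (· ∈ A) i := by
    rw [hitCount_eq_card, Nat.count_eq_card_filter_range]
    congr 1
    ext k
    simp only [hA, Finset.mem_filter, Finset.mem_range]
    constructor <;> intro h <;> refine ⟨h.1, ?_⟩
    · exact ⟨by omega, h.2⟩
    · exact h.2.2
  have hfin : (Set.ofPred (· ∈ A)).Finite := A.finite_toSet
  have hto : hfin.toFinset = A := by ext; simp
  have hnth : Nat.nth (· ∈ A) (Nat.count (· ∈ A) i) = i := Nat.nth_count hiA
  have hlt : Nat.count (· ∈ A) i < (A.sort (· ≤ ·)).length := by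
    have := Nat.count_lt_card hfin hiA
    simpa [hto] using this
  rw [Nat.nth_eq_getD_sort hfin, hto, List.getD_eq_getElem _ _ hlt] at hnth
  rw [tauIndex, ← hA, hcount, Nat.add_sub_cancel, List.getD_eq_getElem _ _ hlt, hnth]

lemma missCount_le_ncard (E : ℕ → Set Ω) (M : ℕ) :
    missCount (fun i => {ω | f i ω < α}) E M (K + 1) ω ≤
      ({j : ℕ | 1 ≤ j ∧ j ≤ M ∧ ω ∉ E (tauIndex K α f j ω)}).ncard := by
  classical
  set S : ℕ → Set Ω := fun i => {ω | f i ω < α}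
  have hcard : missCount S E M (K + 1) ω = ((Finset.range (K + 1)).filter fun i =>
      ω ∈ (S i \ E i) ∩ {ω | hitCount S i ω < M}).card := by
    simp only [missCount, Set.indicator_apply, Finset.card_filter]
  rw [hcard, ← Set.ncard_coe_finset]
  have htau : ∀ i ∈ ((Finset.range (K + 1)).filter fun i =>
      ω ∈ (S i \ E i) ∩ {ω | hitCount S i ω < M}),
      tauIndex K α f (hitCount S i ω + 1) ω = i := by
    intro i hi
    rw [Finset.mem_filter, Finset.mem_range] at hi
    exact tauIndex_hitCount_succ (by omega) hi.2.1.1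
  refine Set.ncard_le_ncard_of_injOn (fun i => hitCount S i ω + 1) (fun i hi => ?_)
    (fun i hi j hj hij => ?_) ((Set.finite_Icc 1 M).subset fun j hj => ⟨hj.1, hj.2.1⟩)
  · have h := htau i hi
    have hi := (Finset.mem_filter.1 hi).2
    refine ⟨by omega, hi.2, ?_⟩
    rw [h]
    exact hi.1.2
  · rw [← htau i hi, ← htau j hj]
    exact congrArg (tauIndex K α f · ω) hij

end TauIndex

theorem stmt_4 {Ω : Type*} [m𝓜 : MeasurableSpace Ω] (P : Measure Ω) [IsProbabilityMeasure P]
    (K : ℕ) (𝓕 : ℕ → MeasurableSpace Ω)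
    (h𝓕le : ∀ k ≤ K, 𝓕 k ≤ m𝓜)
    (h𝓕mono : ∀ j k, j ≤ k → k ≤ K → 𝓕 j ≤ 𝓕 k)
    (E : ℕ → Set Ω) (hEmeas : ∀ k ≤ K, MeasurableSet (E k))
    (hadapted : ∀ k, k + 1 ≤ K → MeasurableSet[𝓕 (k + 1)] (E k))
    (α : ℝ) (hα : α ∈ Set.Ioo (0 : ℝ) 1)
    (f : ℕ → Ω → ℝ)
    (hfmeas : ∀ k ≤ K, Measurable[𝓕 k] (f k))
    (hfver : ∀ k ≤ K, f k =ᵐ[P] P[(E k).indicator (fun _ => (1 : ℝ)) | 𝓕 k])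
    (m n : ℕ) :
    P {ω | tauIndex K α f (m + 1) ω ≤ K
          ∧ ({j : ℕ | 1 ≤ j ∧ j ≤ m + 1 ∧ ω ∉ E (tauIndex K α f j ω)}).ncard ≤ n}
      ≤ ENNReal.ofReal (∑ i ∈ Finset.range (n + 1),
          ((m + 1).choose i : ℝ) * (1 - α) ^ i * α ^ (m + 1 - i)) := by
  have h0 := hα.1.le
  have h1 := hα.2.le
  set S : ℕ → Set Ω := fun i => {ω | f i ω < α}
  set X := binomProcess α S E (m + 1) (n + 1) with hX
  have hSmeas : ∀ j ≤ K, ∀ i ≤ j, MeasurableSet[𝓕 j] (S i) := fun j hj i hij =>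
    h𝓕mono i j hij hj _ (hfmeas i (hij.trans hj) measurableSet_Iio)
  have hXmeas : ∀ k ≤ K + 1, Measurable (X k) := fun k hk =>
    measurable_binomProcess α (fun i hi => h𝓕le i (by omega) _ (hSmeas i (by omega) i le_rfl))
      (fun i hi => hEmeas i (by omega)) _ _
  have hX0 : ∀ k ω, 0 ≤ X k ω := fun k ω => binomLT_nonneg h0 h1 _ _
  have hXint : ∀ k ≤ K + 1, Integrable (X k) P := fun k hk =>
    .of_bound (hXmeas k hk).aestronglyMeasurable 1 (.of_forall fun ω => by
      rw [Real.norm_of_nonneg (hX0 k ω)]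
      exact binomLT_le_one h0 h1 _ _)
  have hstep : ∀ k ≤ K, ∫ ω, X (k + 1) ω ∂P ≤ ∫ ω, X k ω ∂P := by
    intro k hk
    have hle : ∫ ω, binomWeight α S E (m + 1) (n + 1) k ω *
        ((E k).indicator (fun _ => (1 : ℝ)) ω - α) ∂P ≤ 0 := by
      refine integral_mul_indicator_sub_nonpos (h𝓕le k hk) (hEmeas k hk) (hfver k hk)
        (measurable_binomWeight α (fun i hi => hSmeas k hk i (by omega)) (fun i hi => ?_) _ _)
        (binomWeight_nonneg h0 h1 _ _ _ _ _) (abs_binomWeight_le h0 h1 _ _ _ _ _)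
        fun ω hω => ?_
      · exact h𝓕mono (i + 1) k hi hk _ (hadapted i (by omega))
      · exact (show f k ω < α from (Set.mem_of_indicator_ne_zero hω).1).le
    have hsub : ∫ ω, (X (k + 1) ω - X k ω) ∂P ≤ 0 := by
      simpa only [hX, binomProcess_succ, add_sub_cancel_left] using hle
    rw [integral_sub (hXint _ (by omega)) (hXint _ (by omega))] at hsub
    linarith
  have hbound : ∀ k ≤ K + 1, ∫ ω, X k ω ∂P ≤ binomLT α (m + 1) (n + 1) := by
    intro k
    induction k with
    | zero => simp [hX, binomProcess, hitCount, missCount]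
    | succ k ih => exact fun hk => (hstep k (by omega)).trans (ih (by omega))
  rw [← binomLT_eq_sum]
  calc P _ ≤ P {ω | 1 ≤ X (K + 1) ω} := by
        refine measure_mono fun ω hω => ?_
        have hN := le_hitCount_of_tauIndex_le hω.1
        have hF : missCount S E (m + 1) (K + 1) ω ≤ n :=
          (missCount_le_ncard E (m + 1)).trans hω.2
        simp only [Set.mem_ofPred_eq, hX, binomProcess]
        rw [Nat.sub_eq_zero_of_le hN, binomLT, if_neg (by omega)]
    _ = ENNReal.ofReal (P.real {ω | 1 ≤ X (K + 1) ω}) := by simp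
    _ ≤ _ := by
        refine ENNReal.ofReal_le_ofReal (le_trans ?_ (hbound (K + 1) le_rfl))
        simpa using mul_meas_ge_le_integral_of_nonneg (.of_forall (hX0 _))
          (hXint (K + 1) le_rfl) 1
end

section
/- Let (Ω, 𝓜, P) be a probability space, let K ∈ ℕ, let 𝓕₀ ⊆ 𝓕₁ ⊆ ⋯ ⊆ 𝓕_{K+1} ⊆ 𝓜 be sub-σ-algebras, and let E₀, …, E_K ∈ 𝓜 be events with E_k ∈ 𝓕_{k+1} for each 0 ≤ k ≤ K. Let α ∈ [0,1] and suppose that for each 0 ≤ k ≤ K, almost surely P[E_k | 𝓕_k] ≥ α. Then for every β ∈ [0, α], P[ ∑_{k=0}^{K} 1_{E_k} ≤ β·(K+1) ] ≤ exp( −2(α−β)²(K+1) ). -/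
open MeasureTheory

/-- Hoeffding's lemma for a Bernoulli variable with parameter `α`. -/
lemma one_sub_add_mul_exp_neg_le {α : ℝ} (hα : α ∈ Set.Icc (0 : ℝ) 1) (t : ℝ) :
    1 - α + α * Real.exp (-t) ≤ Real.exp (-t * α + t ^ 2 / 8) := by
  let μ : Measure ℝ :=
    ENNReal.ofReal α • Measure.dirac 1 + ENNReal.ofReal (1 - α) • Measure.dirac 0
  have hα' : 0 ≤ 1 - α := by linarith [hα.2]
  have hint (f : ℝ → ℝ) : ∫ x, f x ∂μ = α * f 1 + (1 - α) * f 0 := by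
    rw [integral_add_measure ((integrable_dirac (by simp)).smul_measure ENNReal.ofReal_ne_top)
      ((integrable_dirac (by simp)).smul_measure ENNReal.ofReal_ne_top)]
    simp [integral_smul_measure, ENNReal.toReal_ofReal, hα.1, hα']
  have : IsProbabilityMeasure μ := ⟨by
    simp [μ, ← ENNReal.ofReal_add hα.1 hα']⟩
  have hsupp : ∀ᵐ x ∂μ, id x ∈ Set.Icc (0 : ℝ) 1 := by
    rw [ae_add_measure_iff]
    exact ⟨Measure.ae_smul_measure (by simp [ae_dirac_eq]) _,
      Measure.ae_smul_measure (by simp [ae_dirac_eq]) _⟩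
  have h := (ProbabilityTheory.hasSubgaussianMGF_of_mem_Icc
    (X := id) aemeasurable_id hsupp).mgf_le (-t)
  rw [ProbabilityTheory.mgf, hint, hint] at h
  have h' : α * Real.exp (-t * (1 - α)) + (1 - α) * Real.exp (t * α) ≤ Real.exp (t ^ 2 / 8) := by
    convert h using 2
    · simp
    · simp
    · norm_num
      ring
  calc 1 - α + α * Real.exp (-t)
      = Real.exp (-t * α) *
        (α * Real.exp (-t * (1 - α)) + (1 - α) * Real.exp (t * α)) := by
        have h1 : Real.exp (-t * α) * Real.exp (-t * (1 - α)) = Real.exp (-t) := by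
          rw [← Real.exp_add]; ring_nf
        have h2 : Real.exp (-t * α) * Real.exp (t * α) = 1 := by
          rw [← Real.exp_add]; ring_nf; simp
        linear_combination -α * h1 - (1 - α) * h2
    _ ≤ Real.exp (-t * α + t ^ 2 / 8) := by
        rw [Real.exp_add]; gcongr

/-- A conditional lower bound on `P[E | m]` integrates against nonnegative `m`-measurable
weights. -/
lemma mul_integral_le_integral_mul_indicator {Ω : Type*} {m m𝓜 : MeasurableSpace Ω}
    {P : Measure Ω} [IsFiniteMeasure P] (hm : m ≤ m𝓜) {E : Set Ω} (hE : MeasurableSet E) {α : ℝ}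
    (hcond : ∀ᵐ ω ∂P, α ≤ (P[E.indicator (fun _ => (1 : ℝ)) | m]) ω)
    {Z : Ω → ℝ} (hZm : StronglyMeasurable[m] Z) (hZ : Integrable Z P) (hZ0 : ∀ ω, 0 ≤ Z ω) :
    α * ∫ ω, Z ω ∂P ≤ ∫ ω, Z ω * E.indicator (fun _ => (1 : ℝ)) ω ∂P := by
  have hind : Integrable (E.indicator (fun _ => (1 : ℝ))) P :=
    (integrable_const 1).indicator hE
  have hprod : Integrable (Z * E.indicator (fun _ => (1 : ℝ))) P := by
    refine (hZ.indicator hE).congr (.of_forall fun ω => ?_)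
    by_cases h : ω ∈ E <;> simp [h]
  have hpull := condExp_mul_of_stronglyMeasurable_left hZm hprod hind
  calc α * ∫ ω, Z ω ∂P = ∫ ω, α * Z ω ∂P := (integral_const_mul _ _).symm
    _ ≤ ∫ ω, (P[Z * E.indicator (fun _ => (1 : ℝ)) | m]) ω ∂P := by
        refine integral_mono_ae (hZ.const_mul α) integrable_condExp ?_
        filter_upwards [hpull, hcond] with ω h1 h2
        rw [h1, Pi.mul_apply, mul_comm]
        exact mul_le_mul_of_nonneg_left h2 (hZ0 ω)
    _ = ∫ ω, Z ω * E.indicator (fun _ => (1 : ℝ)) ω ∂P := integral_condExp hm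

/-- The Laplace transform of a count of adapted events with conditional probabilities at least `α`
is bounded by that of a binomial variable. -/
lemma integrable_and_integral_exp_neg_sum_indicator_le {Ω : Type*} {m𝓜 : MeasurableSpace Ω}
    {P : Measure Ω} [IsProbabilityMeasure P] {N : ℕ} {𝓕 : ℕ → MeasurableSpace Ω}
    (h𝓕le : ∀ k ≤ N, 𝓕 k ≤ m𝓜) (h𝓕mono : ∀ j k, j ≤ k → k ≤ N → 𝓕 j ≤ 𝓕 k)
    {E : ℕ → Set Ω} (hadapted : ∀ k < N, MeasurableSet[𝓕 (k + 1)] (E k))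
    {α : ℝ} (hα : α ∈ Set.Icc (0 : ℝ) 1)
    (hcond : ∀ k < N, ∀ᵐ ω ∂P, α ≤ (P[(E k).indicator (fun _ => (1 : ℝ)) | 𝓕 k]) ω)
    {t : ℝ} (ht : 0 ≤ t) {n : ℕ} (hn : n ≤ N) :
    Integrable (fun ω => Real.exp
      (-t * ∑ k ∈ Finset.range n, (E k).indicator (fun _ => (1 : ℝ)) ω)) P ∧
    ∫ ω, Real.exp (-t * ∑ k ∈ Finset.range n, (E k).indicator (fun _ => (1 : ℝ)) ω) ∂P
      ≤ (1 - α + α * Real.exp (-t)) ^ n := by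
  induction n with
  | zero => simp
  | succ n ih =>
    obtain ⟨hZ, hle⟩ := ih (by omega)
    set Z : Ω → ℝ := fun ω => Real.exp
      (-t * ∑ k ∈ Finset.range n, (E k).indicator (fun _ => (1 : ℝ)) ω) with hZdef
    have hE : MeasurableSet (E n) := h𝓕le (n + 1) hn _ (hadapted n hn)
    have hZm : StronglyMeasurable[𝓕 n] Z := by
      refine Real.continuous_exp.comp_stronglyMeasurable (StronglyMeasurable.const_mul ?_ _)
      refine Finset.stronglyMeasurable_fun_sum _ fun k hk => ?_
      have hk' : k < n := Finset.mem_range.1 hk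
      exact stronglyMeasurable_const.indicator
        (h𝓕mono (k + 1) n hk' (by omega) _ (hadapted k (by omega)))
    have hstep : (fun ω => Real.exp
        (-t * ∑ k ∈ Finset.range (n + 1), (E k).indicator (fun _ => (1 : ℝ)) ω)) =
        fun ω => Z ω - (1 - Real.exp (-t)) * (Z ω * (E n).indicator (fun _ => (1 : ℝ)) ω) := by
      funext ω
      rw [Finset.sum_range_succ, mul_add, Real.exp_add]
      by_cases h : ω ∈ E n
      · simp only [hZdef, h, Set.indicator_of_mem]
        ring_nf
      · simp [hZdef, h]
    have hprod : Integrable (fun ω => Z ω * (E n).indicator (fun _ => (1 : ℝ)) ω) P := by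
      refine (hZ.indicator hE).congr (.of_forall fun ω => ?_)
      by_cases h : ω ∈ E n <;> simp [h]
    have hlow := mul_integral_le_integral_mul_indicator (h𝓕le n (by omega)) hE (hcond n hn)
      hZm hZ fun ω => (Real.exp_pos _).le
    have hexp : 0 ≤ 1 - Real.exp (-t) := by
      have : Real.exp (-t) ≤ 1 := Real.exp_le_one_iff.2 (by linarith)
      linarith
    have hc : 0 ≤ 1 - α + α * Real.exp (-t) := by
      have := mul_nonneg hα.1 (Real.exp_pos (-t)).le
      linarith [hα.2]
    rw [hstep]
    refine ⟨hZ.sub (hprod.const_mul _), ?_⟩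
    rw [integral_sub hZ (hprod.const_mul _), integral_const_mul, pow_succ]
    have h1 := mul_le_mul_of_nonneg_left hlow hexp
    have h2 := mul_le_mul_of_nonneg_right hle hc
    linarith

theorem stmt_5 {Ω : Type*} [m𝓜 : MeasurableSpace Ω] (P : Measure Ω) [IsProbabilityMeasure P]
    (K : ℕ) (𝓕 : ℕ → MeasurableSpace Ω)
    (h𝓕le : ∀ k ≤ K + 1, 𝓕 k ≤ m𝓜)
    (h𝓕mono : ∀ j k, j ≤ k → k ≤ K + 1 → 𝓕 j ≤ 𝓕 k)
    (E : ℕ → Set Ω) (hadapted : ∀ k ≤ K, MeasurableSet[𝓕 (k + 1)] (E k))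
    (α : ℝ) (hα : α ∈ Set.Icc (0 : ℝ) 1)
    (hcond : ∀ k ≤ K, ∀ᵐ ω ∂P, α ≤ (P[(E k).indicator (fun _ => (1 : ℝ)) | 𝓕 k]) ω)
    (β : ℝ) (hβ : β ∈ Set.Icc (0 : ℝ) α) :
    P {ω | ∑ k ∈ Finset.range (K + 1), (E k).indicator (fun _ => (1 : ℝ)) ω
            ≤ β * ((K : ℝ) + 1)}
      ≤ ENNReal.ofReal (Real.exp (-2 * (α - β) ^ 2 * ((K : ℝ) + 1))) := by
  have ht : 0 ≤ 4 * (α - β) := by linarith [hβ.2]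
  obtain ⟨hint, hle⟩ := integrable_and_integral_exp_neg_sum_indicator_le h𝓕le h𝓕mono
    (fun k hk => hadapted k (Nat.lt_succ_iff.1 hk)) hα
    (fun k hk => hcond k (Nat.lt_succ_iff.1 hk)) ht le_rfl
  have hc : 0 ≤ 1 - α + α * Real.exp (-(4 * (α - β))) := by
    have := mul_nonneg hα.1 (Real.exp_pos (-(4 * (α - β)))).le
    linarith [hα.2]
  refine (ENNReal.le_ofReal_iff_toReal_le (measure_ne_top _ _) (Real.exp_pos _).le).2 ?_
  calc P.real _ ≤ _ := ProbabilityTheory.measure_le_le_exp_mul_mgf _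
        (neg_nonpos.2 ht) hint
    _ ≤ Real.exp (-(-(4 * (α - β))) * (β * ((K : ℝ) + 1))) *
        Real.exp (-(4 * (α - β)) * α + (4 * (α - β)) ^ 2 / 8) ^ (K + 1) := by
        gcongr
        exact hle.trans (pow_le_pow_left₀ hc (one_sub_add_mul_exp_neg_le hα _) _)
    _ = Real.exp (-2 * (α - β) ^ 2 * ((K : ℝ) + 1)) := by
        rw [← Real.exp_nat_mul, ← Real.exp_add]
        push_cast
        ring_nf
end

section
/- Let (Ω, 𝓜, P) be a probability space, let K ∈ ℕ, let 𝓕₀ ⊆ 𝓕₁ ⊆ ⋯ ⊆ 𝓕_{K+1} ⊆ 𝓜 be sub-σ-algebras, and let E₀, …, E_K ∈ 𝓜 be events with E_k ∈ 𝓕_{k+1} for each 0 ≤ k ≤ K. Let α ∈ [0,1] and suppose that for each 0 ≤ k ≤ K, almost surely P[E_k | 𝓕_k] ≥ α. Then ∑_{k=0}^{K} 1_{E_k} stochastically dominates a binomial random variable with K+1 trials and success probability α: for every integer n with 0 ≤ n ≤ K+1, P[ ∑_{k=0}^{K} 1_{E_k} ≤ n ] ≤ ∑_{i=0}^{n} C(K+1,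 i) · αⁱ · (1−α)^{K+1−i}. -/
open MeasureTheory

/-- The probability that a binomial variable with `m` trials and success probability `a` is
smaller than `n`. -/
noncomputable def binomialLT (a : ℝ) (m n : ℕ) : ℝ :=
  ∑ i ∈ Finset.range n, (m.choose i : ℝ) * a ^ i * (1 - a) ^ (m - i)

lemma binomialLT_zero_right (a : ℝ) (m : ℕ) : binomialLT a m 0 = 0 := by
  simp [binomialLT]

lemma binomialLT_zero_left_succ (a : ℝ) (n : ℕ) : binomialLT a 0 (n + 1) = 1 := by
  simp [binomialLT, Finset.sum_range_succ']

lemma choose_succ_mul_pow (a : ℝ) (m i : ℕ) :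
    ((m + 1).choose (i + 1) : ℝ) * a ^ (i + 1) * (1 - a) ^ (m + 1 - (i + 1)) =
      a * ((m.choose i : ℝ) * a ^ i * (1 - a) ^ (m - i)) +
        (1 - a) * ((m.choose (i + 1) : ℝ) * a ^ (i + 1) * (1 - a) ^ (m - (i + 1))) := by
  rw [Nat.choose_succ_succ, Nat.add_sub_add_right]
  push_cast
  rcases Nat.lt_or_ge i m with h | h
  · rw [show m - i = m - (i + 1) + 1 by omega]
    ring
  · rw [Nat.choose_eq_zero_of_lt (show m < i + 1 by omega)]
    push_cast
    ring

lemma binomialLT_succ_succ (a : ℝ) (m n : ℕ) :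
    binomialLT a (m + 1) (n + 1) =
      a * binomialLT a m n + (1 - a) * binomialLT a m (n + 1) := by
  induction n with
  | zero => simp [binomialLT, pow_succ']
  | succ n ih =>
    have step (m n : ℕ) : binomialLT a m (n + 1) =
        binomialLT a m n + (m.choose n : ℝ) * a ^ n * (1 - a) ^ (m - n) :=
      Finset.sum_range_succ _ _
    rw [step (m + 1) (n + 1), ih, choose_succ_mul_pow, step m (n + 1)]
    linear_combination (-a) * step m n

/-- If the conditional probability of `E` given `𝓗` is at least `a`, then the complement of `E`
takes at most the proportion `1 - a` of every `𝓗`-measurable event. -/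
lemma measureReal_diff_le_of_le_condExp {Ω : Type*} {𝓗 m𝓜 : MeasurableSpace Ω} (P : Measure Ω)
    [IsProbabilityMeasure P] (h𝓗 : 𝓗 ≤ m𝓜) {D E : Set Ω} (hD : MeasurableSet[𝓗] D)
    (hE : MeasurableSet E) {a : ℝ}
    (h : ∀ᵐ ω ∂P, a ≤ (P[E.indicator (fun _ => (1 : ℝ)) | 𝓗]) ω) :
    P.real (D \ E) ≤ (1 - a) * P.real D := by
  have hint : Integrable (E.indicator (fun _ => (1 : ℝ))) P :=
    (integrable_const 1).indicator hE
  have hinter : a * P.real D ≤ P.real (D ∩ E) :=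
    calc a * P.real D = ∫ _ in D, a ∂P := by simp [mul_comm]
      _ ≤ ∫ ω in D, (P[E.indicator (fun _ => (1 : ℝ)) | 𝓗]) ω ∂P :=
        integral_mono_ae (integrable_const a) integrable_condExp.integrableOn
          (ae_restrict_of_ae h)
      _ = ∫ ω in D, E.indicator (fun _ => (1 : ℝ)) ω ∂P := setIntegral_condExp h𝓗 hint hD
      _ = P.real (D ∩ E) := by
        rw [setIntegral_indicator hE]
        simp
  have := measureReal_inter_add_sdiff (μ := P) (s := D) hE
  linarith

/-- The event that fewer than `n` of the events `E 0, …, E (m - 1)` occur. -/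
def countLT {Ω : Type*} (E : ℕ → Set Ω) (m n : ℕ) : Set Ω :=
  {ω | ∑ k ∈ Finset.range m, (E k).indicator (fun _ => (1 : ℕ)) ω < n}

lemma mem_countLT {Ω : Type*} {E : ℕ → Set Ω} {m n : ℕ} {ω : Ω} :
    ω ∈ countLT E m n ↔ ∑ k ∈ Finset.range m, (E k).indicator (fun _ => (1 : ℕ)) ω < n :=
  Iff.rfl

lemma countLT_mono {Ω : Type*} (E : ℕ → Set Ω) (m : ℕ) : Monotone (countLT E m) :=
  fun _ _ h _ hω => lt_of_lt_of_le hω h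

lemma countLT_succ_succ {Ω : Type*} (E : ℕ → Set Ω) (m n : ℕ) :
    countLT E (m + 1) (n + 1) =
      countLT E m n ∪ (countLT E m (n + 1) \ countLT E m n) \ E m := by
  ext ω
  by_cases h : ω ∈ E m <;>
    simp [mem_countLT, Finset.sum_range_succ, h] <;>
    omega

lemma measurableSet_countLT {Ω : Type*} {𝓗 : MeasurableSpace Ω} {E : ℕ → Set Ω} {m : ℕ}
    (hE : ∀ k < m, MeasurableSet (E k)) (n : ℕ) : MeasurableSet (countLT E m n) := by
  refine measurableSet_lt (Finset.measurable_sum _ fun k hk => ?_) measurable_const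
  exact measurable_const.indicator (hE k (Finset.mem_range.1 hk))

/-- Events whose conditional probabilities given the past are at least `a` occur stochastically
at least as often as the successes in independent trials with success probability `a`. -/
lemma measureReal_countLT_le_binomialLT {Ω : Type*} [m𝓜 : MeasurableSpace Ω] (P : Measure Ω)
    [IsProbabilityMeasure P] {𝓕 : ℕ → MeasurableSpace Ω} {E : ℕ → Set Ω} {a : ℝ}
    (ha : a ∈ Set.Icc (0 : ℝ) 1) (m : ℕ) (hle : ∀ k < m, 𝓕 k ≤ m𝓜)
    (hE : ∀ k < m, MeasurableSet (E k)) (hpast : ∀ j k, j < k → k < m → MeasurableSet[𝓕 k] (E j))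
    (hcond : ∀ k < m, ∀ᵐ ω ∂P, a ≤ (P[(E k).indicator (fun _ => (1 : ℝ)) | 𝓕 k]) ω) (n : ℕ) :
    P.real (countLT E m n) ≤ binomialLT a m n := by
  induction m generalizing n with
  | zero =>
    cases n with
    | zero => simp [countLT, binomialLT_zero_right]
    | succ n => exact measureReal_le_one.trans_eq (binomialLT_zero_left_succ a n).symm
  | succ m ih =>
    cases n with
    | zero => simp [countLT, binomialLT_zero_right]
    | succ n =>
      have ih := ih (fun k hk => hle k (by omega)) (fun k hk => hE k (by omega))
        (fun j k hj hk => hpast j k hj (by omega)) (fun k hk => hcond k (by omega))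
      have hmeas (n : ℕ) : MeasurableSet[𝓕 m] (countLT E m n) :=
        measurableSet_countLT (fun k hk => hpast k m hk m.lt_succ_self) n
      have hdiff := measureReal_diff_le_of_le_condExp P (hle m m.lt_succ_self)
        ((hmeas (n + 1)).diff (hmeas n)) (hE m m.lt_succ_self) (hcond m m.lt_succ_self)
      rw [measureReal_sdiff (countLT_mono E m n.le_succ) (hle m m.lt_succ_self _ (hmeas n))]
        at hdiff
      have hunion := measureReal_union_le (μ := P) (countLT E m n)
        ((countLT E m (n + 1) \ countLT E m n) \ E m)
      rw [← countLT_succ_succ] at hunion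
      have hn := mul_le_mul_of_nonneg_left (ih n) ha.1
      have hn' := mul_le_mul_of_nonneg_left (ih (n + 1)) (sub_nonneg.2 ha.2)
      rw [binomialLT_succ_succ]
      linarith


theorem stmt_6 {Ω : Type*} [m𝓜 : MeasurableSpace Ω] (P : Measure Ω) [IsProbabilityMeasure P]
    (K : ℕ) (𝓕 : ℕ → MeasurableSpace Ω)
    (h𝓕le : ∀ k ≤ K + 1, 𝓕 k ≤ m𝓜)
    (h𝓕mono : ∀ j k, j ≤ k → k ≤ K + 1 → 𝓕 j ≤ 𝓕 k)
    (E : ℕ → Set Ω) (hadapted : ∀ k ≤ K, MeasurableSet[𝓕 (k + 1)] (E k))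
    (α : ℝ) (hα : α ∈ Set.Icc (0 : ℝ) 1)
    (hcond : ∀ k ≤ K, ∀ᵐ ω ∂P, α ≤ (P[(E k).indicator (fun _ => (1 : ℝ)) | 𝓕 k]) ω)
    (n : ℕ) (hn : n ≤ K + 1) :
    P {ω | ∑ k ∈ Finset.range (K + 1), (E k).indicator (fun _ => (1 : ℝ)) ω ≤ (n : ℝ)}
      ≤ ENNReal.ofReal (∑ i ∈ Finset.range (n + 1),
          ((K + 1).choose i : ℝ) * α ^ i * (1 - α) ^ (K + 1 - i)) := by
  have hE (k : ℕ) (hk : k < K + 1) : MeasurableSet (E k) :=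
    h𝓕le (k + 1) (by omega) _ (hadapted k (by omega))
  have key := measureReal_countLT_le_binomialLT P hα (K + 1) (fun k hk => h𝓕le k hk.le) hE
    (fun j k hj hk => h𝓕mono (j + 1) k hj hk.le _ (hadapted j (by omega)))
    (fun k hk => hcond k (by omega)) (n + 1)
  have hset : {ω | ∑ k ∈ Finset.range (K + 1), (E k).indicator (fun _ => (1 : ℝ)) ω ≤ (n : ℝ)} =
      countLT E (K + 1) (n + 1) := by
    ext ω
    have hcast : ∑ k ∈ Finset.range (K + 1), (E k).indicator (fun _ => (1 : ℝ)) ω =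
        ((∑ k ∈ Finset.range (K + 1), (E k).indicator (fun _ => (1 : ℕ)) ω : ℕ) : ℝ) := by
      rw [Nat.cast_sum]
      refine Finset.sum_congr rfl fun k _ => ?_
      by_cases h : ω ∈ E k <;> simp [h]
    rw [Set.mem_ofPred_eq, hcast, Nat.cast_le, mem_countLT, Nat.lt_succ_iff]
  rw [hset, ← ofReal_measureReal]
  exact ENNReal.ofReal_le_ofReal key
end

section
/- Let X be a set equipped with two metrics D and D̃, and let C* > 0 satisfy D̃(x, y) ≤ C* · D(x, y) for all x, y ∈ X. Let T ≥ 0 and let P : [0, T] → X satisfy D(P(s), P(t)) = |t − s| for all s, t ∈ [0, T]. Let J ≥ 1 be an integer and let 0 ≤ t₀ ≤ s₁ ≤ t₁ ≤ s₂ ≤ t₂ ≤ ⋯ ≤ s_J ≤ t_J ≤ T. Let C′ ∈ (0, C*] and A > 0, and assume that for each 1 ≤ j ≤ J one has D̃(P(s_j), P(t_j)) ≤ C′ · (t_j − s_j) and s_j − t_{j−1} ≤ A · (t_j − s_j). Then D̃(P(t₀), P(t_J)) ≤ ( C′ + (A/(A+1)) · (C* − C′) ) · (t_J − t₀). -/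
theorem add_le_weighted_mul_add {g l A C C' : ℝ} (hA : 0 < A) (hC : C' ≤ C) (hg : g ≤ A * l) :
    C * g + C' * l ≤ (C' + (A / (A + 1)) * (C - C')) * (g + l) := by
  have hg' : g ≤ A / (A + 1) * (g + l) := by
    rw [div_mul_eq_mul_div, le_div_iff₀ (by linarith)]
    linarith
  have := mul_le_mul_of_nonneg_left hg' (sub_nonneg.2 hC)
  linarith

theorem stmt_9 {X : Type*} (D Dt : X → X → ℝ)
    (hDnonneg : ∀ x y, 0 ≤ D x y) (hDsymm : ∀ x y, D x y = D y x)
    (hDtri : ∀ x y z, D x z ≤ D x y + D y z) (hDzero : ∀ x y, D x y = 0 ↔ x = y)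
    (hDtnonneg : ∀ x y, 0 ≤ Dt x y) (hDtsymm : ∀ x y, Dt x y = Dt y x)
    (hDttri : ∀ x y z, Dt x z ≤ Dt x y + Dt y z) (hDtzero : ∀ x y, Dt x y = 0 ↔ x = y)
    (Cstar : ℝ) (hCstar : 0 < Cstar) (hlip : ∀ x y, Dt x y ≤ Cstar * D x y)
    (T : ℝ) (hT : 0 ≤ T) (P : ℝ → X)
    (hgeo : ∀ s ∈ Set.Icc (0 : ℝ) T, ∀ t ∈ Set.Icc (0 : ℝ) T, D (P s) (P t) = |t - s|)
    (J : ℕ) (hJ : 1 ≤ J) (s t : ℕ → ℝ)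
    (h0 : 0 ≤ t 0) (hTJ : t J ≤ T)
    (hord : ∀ j, 1 ≤ j → j ≤ J → t (j - 1) ≤ s j ∧ s j ≤ t j)
    (C' A : ℝ) (hC' : C' ∈ Set.Ioc (0 : ℝ) Cstar) (hA : 0 < A)
    (hshort : ∀ j, 1 ≤ j → j ≤ J → Dt (P (s j)) (P (t j)) ≤ C' * (t j - s j))
    (hgap : ∀ j, 1 ≤ j → j ≤ J → s j - t (j - 1) ≤ A * (t j - s j)) :
    Dt (P (t 0)) (P (t J)) ≤ (C' + (A / (A + 1)) * (Cstar - C')) * (t J - t 0) := by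
  have hmono : ∀ k m, k ≤ m → m ≤ J → t k ≤ t m := by
    intro k m hkm
    induction m, hkm using Nat.le_induction with
    | base => exact fun _ => le_rfl
    | succ m _ ih =>
      intro hm
      have h := hord (m + 1) (by omega) hm
      rw [Nat.add_sub_cancel] at h
      linarith [ih (by omega), h.1, h.2]
  have hpartial : ∀ k ≤ J, Dt (P (t 0)) (P (t k)) ≤
      (C' + (A / (A + 1)) * (Cstar - C')) * (t k - t 0) := by
    intro k
    induction k with
    | zero => intro _; simp [(hDtzero _ _).2 rfl]
    | succ k ih =>
      intro hk
      have hord' := hord (k + 1) (by omega) hk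
      have hgap' := hgap (k + 1) (by omega) hk
      have hshort' := hshort (k + 1) (by omega) hk
      rw [Nat.add_sub_cancel] at hord' hgap'
      have hlow := hmono 0 k (by omega) (by omega)
      have hupp := hmono (k + 1) J hk le_rfl
      have hlong := hlip (P (t k)) (P (s (k + 1)))
      rw [hgeo _ ⟨by linarith, by linarith⟩ _ ⟨by linarith, by linarith⟩,
        abs_of_nonneg (by linarith)] at hlong
      have hstep := add_le_weighted_mul_add hA hC'.2 hgap'
      have htri₁ := hDttri (P (t 0)) (P (t k)) (P (t (k + 1)))
      have htri₂ := hDttri (P (t k)) (P (s (k + 1))) (P (t (k + 1)))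
      linarith [ih (by omega)]
  exact hpartial J le_rfl
end

section
/- Fix ε > 0 and for (j, k) ∈ ℤ² let S_{j,k} = [jε, (j+1)ε] × [kε, (k+1)ε] ⊆ ℝ². Let S ⊆ ℝ² be a nonempty connected set and let V be the interior of the union of all squares S_{j,k} that intersect S. Then V is an open connected set and S ⊆ V. -/
/-- The interior of the union of the intervals `[jε, (j+1)ε]`, `j : ℤ`, that contain `x`. -/
def gridStar (ε x : ℝ) : Set ℝ :=
  Set.Ioo (((⌈x / ε⌉ : ℝ) - 1) * ε) (((⌊x / ε⌋ : ℝ) + 1) * ε)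

lemma mem_gridStar_self {ε : ℝ} (hε : 0 < ε) (x : ℝ) : x ∈ gridStar ε x := by
  constructor
  · rw [← lt_div_iff₀ hε]
    linarith [Int.ceil_lt_add_one (x / ε)]
  · rw [← div_lt_iff₀ hε]
    exact Int.lt_floor_add_one _

lemma exists_mem_Icc_of_mem_gridStar {ε x y : ℝ} (hε : 0 < ε) (hy : y ∈ gridStar ε x) :
    ∃ j : ℤ, x ∈ Set.Icc ((j : ℝ) * ε) (((j : ℝ) + 1) * ε) ∧
      y ∈ Set.Icc ((j : ℝ) * ε) (((j : ℝ) + 1) * ε) := by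
  obtain ⟨hx₁, hx₂⟩ := mem_gridStar_self hε x
  obtain ⟨hy₁, hy₂⟩ := hy
  rcases le_total x y with h | h
  · have hj : (⌊x / ε⌋ : ℝ) * ε ≤ x := (le_div_iff₀ hε).1 (Int.floor_le _)
    exact ⟨⌊x / ε⌋, ⟨hj, hx₂.le⟩, hj.trans h, hy₂.le⟩
  · have hj : x ≤ (⌈x / ε⌉ : ℝ) * ε := (div_le_iff₀ hε).1 (Int.le_ceil _)
    refine ⟨⌈x / ε⌉ - 1, ?_⟩
    push_cast
    rw [sub_add_cancel]
    exact ⟨⟨hx₁.le, hj⟩, hy₁.le, h.trans hj⟩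

lemma Ioo_subset_gridStar {ε x : ℝ} (hε : 0 < ε) {j : ℤ}
    (hx : x ∈ Set.Icc ((j : ℝ) * ε) (((j : ℝ) + 1) * ε)) :
    Set.Ioo ((j : ℝ) * ε) (((j : ℝ) + 1) * ε) ⊆ gridStar ε x := by
  have hf : j ≤ ⌊x / ε⌋ := Int.le_floor.2 ((le_div_iff₀ hε).2 hx.1)
  have hc : ⌈x / ε⌉ ≤ j + 1 := Int.ceil_le.2 (by push_cast; exact (div_le_iff₀ hε).2 hx.2)
  have hf' : (j : ℝ) ≤ ⌊x / ε⌋ := by exact_mod_cast hf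
  have hc' : (⌈x / ε⌉ : ℝ) ≤ j + 1 := by exact_mod_cast hc
  apply Set.Ioo_subset_Ioo
  · exact mul_le_mul_of_nonneg_right (by linarith) hε.le
  · exact mul_le_mul_of_nonneg_right (by linarith) hε.le

lemma IsConnected.biUnion_of_mem {α : Type*} [TopologicalSpace α] {S : Set α}
    (hS : IsConnected S) {N : α → Set α} (hN : ∀ p ∈ S, IsPreconnected (N p))
    (hmem : ∀ p ∈ S, p ∈ N p) : IsConnected (⋃ p ∈ S, N p) := by
  have hsub : S ⊆ ⋃ p ∈ S, N p := fun p hp => Set.mem_biUnion hp (hmem p hp)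
  obtain ⟨p₀, hp₀⟩ := hS.nonempty
  refine ⟨⟨p₀, hsub hp₀⟩, isPreconnected_of_forall p₀ fun y hy => ?_⟩
  obtain ⟨p, hp, hyp⟩ := Set.mem_iUnion₂.1 hy
  exact ⟨S ∪ N p, Set.union_subset hsub (Set.subset_biUnion_of_mem hp), Or.inl hp₀, Or.inr hyp,
    hS.isPreconnected.union p hp (hmem p hp) (hN p hp)⟩

theorem stmt_13 (ε : ℝ) (hε : 0 < ε) (S : Set (ℝ × ℝ)) (hS : IsConnected S)
    (V : Set (ℝ × ℝ))
    (hV : V = interior (⋃ jk : ℤ × ℤ,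
      ⋃ (_ : ((Set.Icc ((jk.1 : ℝ) * ε) (((jk.1 : ℝ) + 1) * ε) ×ˢ
               Set.Icc ((jk.2 : ℝ) * ε) (((jk.2 : ℝ) + 1) * ε)) ∩ S).Nonempty),
        Set.Icc ((jk.1 : ℝ) * ε) (((jk.1 : ℝ) + 1) * ε) ×ˢ
          Set.Icc ((jk.2 : ℝ) * ε) (((jk.2 : ℝ) + 1) * ε))) :
    IsOpen V ∧ IsConnected V ∧ S ⊆ V := by
  subst hV
  set N : ℝ × ℝ → Set (ℝ × ℝ) := fun p => gridStar ε p.1 ×ˢ gridStar ε p.2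
  have hmem : ∀ p ∈ S, p ∈ N p := fun p _ =>
    ⟨mem_gridStar_self hε p.1, mem_gridStar_self hε p.2⟩
  have hW : IsConnected (⋃ p ∈ S, N p) :=
    hS.biUnion_of_mem (fun p _ => isPreconnected_Ioo.prod isPreconnected_Ioo) hmem
  have hopen : IsOpen (⋃ p ∈ S, N p) :=
    isOpen_biUnion fun p _ => isOpen_Ioo.prod isOpen_Ioo
  have hWV := interior_maximal (s := ⋃ jk : ℤ × ℤ,
      ⋃ (_ : ((Set.Icc ((jk.1 : ℝ) * ε) (((jk.1 : ℝ) + 1) * ε) ×ˢ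
               Set.Icc ((jk.2 : ℝ) * ε) (((jk.2 : ℝ) + 1) * ε)) ∩ S).Nonempty),
        Set.Icc ((jk.1 : ℝ) * ε) (((jk.1 : ℝ) + 1) * ε) ×ˢ
          Set.Icc ((jk.2 : ℝ) * ε) (((jk.2 : ℝ) + 1) * ε)) (t := ⋃ p ∈ S, N p) (by
    refine Set.iUnion₂_subset fun p hp q hq => ?_
    obtain ⟨j, hpj, hqj⟩ := exists_mem_Icc_of_mem_gridStar hε hq.1
    obtain ⟨k, hpk, hqk⟩ := exists_mem_Icc_of_mem_gridStar hε hq.2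
    exact Set.mem_iUnion₂.2 ⟨(j, k), ⟨p, ⟨hpj, hpk⟩, hp⟩, hqj, hqk⟩) hopen
  refine ⟨isOpen_interior, hW.subset_closure hWV (interior_subset.trans ?_),
    fun p hp => hWV (Set.mem_biUnion hp (hmem p hp))⟩
  refine Set.iUnion₂_subset fun jk ⟨p, hpQ, hp⟩ => ?_
  have hne : ∀ j : ℤ, (j : ℝ) * ε ≠ ((j : ℝ) + 1) * ε := fun j => by
    rw [add_mul]; linarith
  rw [← closure_Ioo (hne jk.1), ← closure_Ioo (hne jk.2), ← closure_prod_eq]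
  exact closure_mono ((Set.prod_mono (Ioo_subset_gridStar hε hpQ.1)
    (Ioo_subset_gridStar hε hpQ.2)).trans (Set.subset_biUnion_of_mem (u := N) hp))
end
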